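/- There exists a universal constant C > 0 with the following property. Let ω : ℝ² → ℝ and v = (v₁, v₂) : ℝ² → ℝ² be Schwartz functions satisfying the two-dimensional Biot–Savart relation −Δv = (∂_{x₂}ω, −∂_{x₁}ω) (equivalently, ∇·v = 0 and ∂_{x₁}v₂ − ∂_{x₂}v₁ = ω). Then ‖v‖_{L^∞(ℝ²)} + ‖∇v‖_{L²(ℝ²)} ≤ C ‖∇ω‖_{L¹(ℝ²)}. -/

import Mathlib

open MeasureTheory Real
open scoped ENNReal

noncomputable section

/-- The plane `ℝ²` with its Euclidean structure. -/
abbrev E2 := EuclideanSpace ℝ (Fin 2)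

/-- Partial derivative in the `i`-th coordinate direction. -/
def pd (i : Fin 2) (f : E2 → ℝ) (x : E2) : ℝ :=
  fderiv ℝ f x (EuclideanSpace.single i 1)

/-- Componentwise Laplacian of a (possibly vector-valued) function on `ℝ²`. -/
def lap {F : Type*} [NormedAddCommGroup F] [NormedSpace ℝ F] (f : E2 → F) (x : E2) : F :=
  ∑ i : Fin 2, fderiv ℝ (fun y => fderiv ℝ f y (EuclideanSpace.single i 1)) x
    (EuclideanSpace.single i 1)

open SchwartzMap LineDeriv

/-- The point of the unit circle with polar angle `θ`. -/
def unitDir (θ : ℝ) : E2 :=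
  cos θ • EuclideanSpace.single 0 1 + sin θ • EuclideanSpace.single 1 1

/-- The derivative of `unitDir`, the unit tangent vector of the circle at polar angle `θ`. -/
def unitTangent (θ : ℝ) : E2 :=
  (-sin θ) • EuclideanSpace.single 0 1 + cos θ • EuclideanSpace.single 1 1

lemma norm_unitDir (θ : ℝ) : ‖unitDir θ‖ = 1 := by
  simp [unitDir, EuclideanSpace.norm_eq]

lemma norm_unitTangent (θ : ℝ) : ‖unitTangent θ‖ = 1 := by
  simp [unitTangent, EuclideanSpace.norm_eq]

lemma hasDerivAt_unitDir (θ : ℝ) : HasDerivAt unitDir (unitTangent θ) θ :=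
  ((hasDerivAt_cos θ).smul_const _).add ((hasDerivAt_sin θ).smul_const _)

@[fun_prop]
lemma continuous_unitDir : Continuous unitDir := by unfold unitDir; fun_prop

@[fun_prop]
lemma continuous_unitTangent : Continuous unitTangent := by unfold unitTangent; fun_prop

/-- The measure `dr dθ` on the open half-strip of polar coordinates. -/
def polarMeasure : Measure (ℝ × ℝ) :=
  (volume.restrict (Set.Ioi 0)).prod (volume.restrict (Set.Ioo (-π) π))

section Polar

variable {F : Type*} [NormedAddCommGroup F] [NormedSpace ℝ F]

lemma exists_bound_along_rays (f : SchwartzMap E2 F) :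
    ∃ C : ℝ, ∀ r θ : ℝ, ‖f (r • unitDir θ)‖ ≤ C * (1 + r ^ 2)⁻¹ := by
  obtain ⟨A, -, hA⟩ := f.decay 0 0
  obtain ⟨B, -, hB⟩ := f.decay 2 0
  refine ⟨A + B, fun r θ => ?_⟩
  have h1 := hA (r • unitDir θ)
  have h2 := hB (r • unitDir θ)
  simp only [pow_zero, one_mul, norm_iteratedFDeriv_zero, norm_smul, norm_unitDir, mul_one,
    norm_eq_abs, sq_abs] at h1 h2
  rw [← div_eq_mul_inv, le_div_iff₀ (by positivity)]
  linarith

lemma integrable_ray (f : SchwartzMap E2 F) (θ : ℝ) :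
    Integrable (fun r : ℝ => f (r • unitDir θ)) := by
  obtain ⟨C, hC⟩ := exists_bound_along_rays f
  exact (integrable_inv_one_add_sq.const_mul C).mono'
    (f.continuous.comp (by fun_prop)).aestronglyMeasurable (ae_of_all _ fun r => hC r θ)

lemma tendsto_ray (f : SchwartzMap E2 F) (θ : ℝ) :
    Filter.Tendsto (fun r : ℝ => f (r • unitDir θ)) Filter.atTop (nhds 0) := by
  refine (zero_at_infty f.toZeroAtInfty).comp ?_
  rw [← Metric.cobounded_eq_cocompact, ← tendsto_norm_atTop_iff_cobounded]
  simpa [norm_smul, norm_unitDir] using Filter.tendsto_abs_atTop_atTop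

lemma hasDerivAt_ray (f : SchwartzMap E2 F) (r θ : ℝ) :
    HasDerivAt (fun r : ℝ => f (r • unitDir θ)) (fderiv ℝ f (r • unitDir θ) (unitDir θ)) r := by
  have h : HasDerivAt (fun r : ℝ => r • unitDir θ) (unitDir θ) r := by
    simpa using (hasDerivAt_id r).smul_const (unitDir θ)
  exact (f.hasFDerivAt _).comp_hasDerivAt r h

lemma hasDerivAt_circle (f : SchwartzMap E2 F) (r θ : ℝ) :
    HasDerivAt (fun θ : ℝ => f (r • unitDir θ))
      (r • fderiv ℝ f (r • unitDir θ) (unitTangent θ)) θ := by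
  rw [← map_smul]
  exact (f.hasFDerivAt _).comp_hasDerivAt θ ((hasDerivAt_unitDir θ).const_smul r)

lemma continuous_fderiv_polar (f : SchwartzMap E2 F) {w : ℝ → E2} (hw : Continuous w) :
    Continuous fun p : ℝ × ℝ => fderiv ℝ f (p.1 • unitDir p.2) (w p.2) :=
  ((fderivCLM ℝ E2 F f).continuous.comp (by fun_prop :
    Continuous fun p : ℝ × ℝ => p.1 • unitDir p.2)).clm_apply (hw.comp continuous_snd)

lemma integrable_fderiv_polar (f : SchwartzMap E2 F) {w : ℝ → E2} (hw : Continuous w)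
    (hw1 : ∀ θ, ‖w θ‖ = 1) :
    Integrable (fun p : ℝ × ℝ => fderiv ℝ f (p.1 • unitDir p.2) (w p.2)) polarMeasure := by
  obtain ⟨C, hC⟩ := exists_bound_along_rays (fderivCLM ℝ E2 F f)
  have h : Integrable (fun p : ℝ × ℝ => C * (1 + p.1 ^ 2)⁻¹ * 1) polarMeasure :=
    (integrable_inv_one_add_sq.restrict.const_mul C).mul_prod (integrable_const (1 : ℝ))
  refine h.mono' ?_ (ae_of_all _ fun p => ?_)
  · exact (continuous_fderiv_polar f hw).aestronglyMeasurable
  · refine (ContinuousLinearMap.le_opNorm _ _).trans ?_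
    rw [hw1]
    gcongr
    exact hC _ _

variable [CompleteSpace F]

lemma integral_fderiv_ray (f : SchwartzMap E2 F) (θ : ℝ) :
    ∫ r in Set.Ioi (0 : ℝ), fderiv ℝ f (r • unitDir θ) (unitDir θ) = -f 0 := by
  rw [integral_Ioi_of_hasDerivAt_of_tendsto' (fun r _ => hasDerivAt_ray f r θ) _ (tendsto_ray f θ)]
  · simp
  · exact ((integrable_ray (fderivCLM ℝ E2 F f) θ).apply_continuousLinearMap _).integrableOn

lemma integral_polar_radial (f : SchwartzMap E2 F) :
    ∫ p, fderiv ℝ f (p.1 • unitDir p.2) (unitDir p.2) ∂polarMeasure = -((2 * π) • f 0) := by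
  rw [polarMeasure, integral_prod_symm _
    (integrable_fderiv_polar f continuous_unitDir norm_unitDir)]
  simp only [integral_fderiv_ray]
  simp [pi_pos.le, two_mul]

lemma integral_polar_tangential (f : SchwartzMap E2 F) :
    ∫ p, fderiv ℝ f (p.1 • unitDir p.2) (unitTangent p.2) ∂polarMeasure = 0 := by
  rw [polarMeasure, integral_prod _
    (integrable_fderiv_polar f continuous_unitTangent norm_unitTangent)]
  refine setIntegral_eq_zero_of_forall_eq_zero fun r (hr : 0 < r) => ?_
  have hcont : Continuous fun θ : ℝ => fderiv ℝ f (r • unitDir θ) (unitTangent θ) :=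
    (continuous_fderiv_polar f continuous_unitTangent).comp (Continuous.prodMk_right r)
  have h := intervalIntegral.integral_eq_sub_of_hasDerivAt (a := -π) (b := π)
    (fun θ _ => hasDerivAt_circle f r θ) ((hcont.const_smul r).intervalIntegrable _ _)
  rw [← integral_Ioc_eq_integral_Ioo,
    ← intervalIntegral.integral_of_le (by linarith [pi_pos])]
  simpa [intervalIntegral.integral_smul, hr.ne', unitDir] using h

lemma enorm_ray_le (f : SchwartzMap E2 F) (r θ : ℝ) :
    ‖f (r • unitDir θ)‖ₑ ≤ ∫⁻ s in Set.Ioi r, ‖fderiv ℝ f (s • unitDir θ)‖ₑ := by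
  have h := integral_Ioi_of_hasDerivAt_of_tendsto' (a := r)
    (fun r _ => hasDerivAt_ray f r θ)
    ((integrable_ray (fderivCLM ℝ E2 F f) θ).apply_continuousLinearMap _).integrableOn
    (tendsto_ray f θ)
  rw [← enorm_neg, ← zero_sub, ← h]
  refine (enorm_integral_le_lintegral_enorm _).trans (lintegral_mono fun s => ?_)
  refine (ContinuousLinearMap.le_opENorm _ _).trans ?_
  rw [← ofReal_norm (unitDir θ), norm_unitDir]
  simp

lemma lintegral_ray_le (f : SchwartzMap E2 F) (θ : ℝ) :
    ∫⁻ r in Set.Ioi (0 : ℝ), ‖f (r • unitDir θ)‖ₑ ≤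
      ∫⁻ r in Set.Ioi (0 : ℝ), ENNReal.ofReal r * ‖fderiv ℝ f (r • unitDir θ)‖ₑ := by
  set g : ℝ → ℝ≥0∞ := fun s => ‖fderiv ℝ f (s • unitDir θ)‖ₑ with hg
  have hgm : Measurable g :=
    ((fderivCLM ℝ E2 F f).continuous.comp (by fun_prop :
      Continuous fun r : ℝ => r • unitDir θ)).enorm.measurable
  calc ∫⁻ r in Set.Ioi (0 : ℝ), ‖f (r • unitDir θ)‖ₑ
      ≤ ∫⁻ r in Set.Ioi (0 : ℝ), ∫⁻ s in Set.Ioi r, g s :=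
        lintegral_mono fun r => enorm_ray_le f r θ
    _ = ∫⁻ r in Set.Ioi (0 : ℝ), ∫⁻ s in Set.Ioi (0 : ℝ), (Set.Ioi r).indicator g s := by
        refine setLIntegral_congr_fun measurableSet_Ioi fun r (hr : 0 < r) => ?_
        rw [lintegral_indicator measurableSet_Ioi, Measure.restrict_restrict measurableSet_Ioi,
          Set.Ioi_inter_Ioi, sup_of_le_left hr.le]
    _ = ∫⁻ s in Set.Ioi (0 : ℝ), ∫⁻ r in Set.Ioi (0 : ℝ), (Set.Ioi r).indicator g s := by
        refine lintegral_lintegral_swap (Measurable.aemeasurable ?_)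
        exact (hgm.comp measurable_snd).indicator
          (measurableSet_lt measurable_fst measurable_snd)
    _ = ∫⁻ r in Set.Ioi (0 : ℝ), ENNReal.ofReal r * g r := by
        refine setLIntegral_congr_fun measurableSet_Ioi fun s (hs : 0 < s) => ?_
        have : ∀ r : ℝ, (Set.Ioi r).indicator g s = (Set.Iio s).indicator (fun _ => g s) r := by
          intro r
          simp [Set.indicator_apply]
        simp only [this]
        rw [lintegral_indicator measurableSet_Iio, Measure.restrict_restrict measurableSet_Iio,
          setLIntegral_const, Set.Iio_inter_Ioi, volume_Ioo, sub_zero, mul_comm]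

lemma lintegral_polar (g : E2 → ℝ≥0∞) (hg : Measurable g) :
    ∫⁻ p, ENNReal.ofReal p.1 * g (p.1 • unitDir p.2) ∂polarMeasure = ∫⁻ x, g x := by
  have h := lintegral_comp_polarCoord_symm fun q : ℝ × ℝ => g !₂[q.1, q.2]
  rw [← (PiLp.volume_preserving_toLp (Fin 2)).lintegral_comp hg,
    ← (volume_preserving_finTwoArrow ℝ).symm.lintegral_comp_emb
      (MeasurableEquiv.measurableEmbedding _)]
  convert! h using 2
  · rw [polarMeasure, Measure.prod_restrict]
    rfl
  · ext p
    simp only [smul_eq_mul, unitDir]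
    congr 2
    ext i
    fin_cases i <;> simp

lemma lintegral_polar_le (f : SchwartzMap E2 F) :
    ∫⁻ p, ‖f (p.1 • unitDir p.2)‖ₑ ∂polarMeasure ≤ ∫⁻ x, ‖fderiv ℝ f x‖ₑ := by
  have hm : Measurable fun x => ‖fderiv ℝ f x‖ₑ :=
    (fderivCLM ℝ E2 F f).continuous.enorm.measurable
  have hc : Continuous fun p : ℝ × ℝ => p.1 • unitDir p.2 := by fun_prop
  have hf : Continuous fun p : ℝ × ℝ => ‖f (p.1 • unitDir p.2)‖ₑ := (f.continuous.comp hc).enorm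
  have hg : Measurable fun p : ℝ × ℝ =>
      ENNReal.ofReal p.1 * ‖fderiv ℝ f (p.1 • unitDir p.2)‖ₑ :=
    (ENNReal.measurable_ofReal.comp measurable_fst).mul (hm.comp hc.measurable)
  rw [← lintegral_polar _ hm, polarMeasure,
    lintegral_prod_symm _ hf.measurable.aemeasurable,
    lintegral_prod_symm _ hg.aemeasurable]
  exact lintegral_mono fun θ => lintegral_ray_le f θ

/-- If the radial derivative of `u` and the tangential derivative of `w` add up to a multiple
`k θ * ω` of `ω` with `|k| ≤ 1`, then `u` is bounded by the `L¹` norm of `∇ω`. -/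
lemma enorm_apply_le (u w ω : SchwartzMap E2 ℝ) (k : ℝ → ℝ) (hk : ∀ θ, |k θ| ≤ 1)
    (h : ∀ x θ, fderiv ℝ u x (unitDir θ) + fderiv ℝ w x (unitTangent θ) = k θ * ω x) (a : E2) :
    2 * ‖u a‖ₑ ≤ ∫⁻ x, ‖fderiv ℝ ω x‖ₑ := by
  set T := compSubConstCLM (F := ℝ) ℝ (-a)
  have hT : ∀ (f : SchwartzMap E2 ℝ) x, fderiv ℝ (T f) x = fderiv ℝ f (x + a) := fun f x => by
    have : (T f : E2 → ℝ) = fun x => f (x + a) := by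
      ext x
      simp [T]
    rw [this, fderiv_comp_add_right]
  have h0 : T u 0 = u a := by simp [T]
  have key : -((2 * π) • u a) = ∫ p, k p.2 * T ω (p.1 • unitDir p.2) ∂polarMeasure := by
    rw [← h0, ← integral_polar_radial, ← add_zero (∫ p, _ ∂_),
      ← integral_polar_tangential (T w), ← integral_add
        (integrable_fderiv_polar _ continuous_unitDir norm_unitDir)
        (integrable_fderiv_polar _ continuous_unitTangent norm_unitTangent)]
    simp only [hT, h]
    simp [T]
  calc 2 * ‖u a‖ₑ ≤ ‖-((2 * π) • u a)‖ₑ := by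
        rw [enorm_neg, enorm_smul]
        gcongr
        rw [Real.enorm_of_nonneg (by positivity), ← ENNReal.ofReal_ofNat]
        exact ENNReal.ofReal_le_ofReal (by linarith [pi_gt_three])
    _ ≤ ∫⁻ p, ‖k p.2 * T ω (p.1 • unitDir p.2)‖ₑ ∂polarMeasure := by
        rw [key]
        exact enorm_integral_le_lintegral_enorm _
    _ ≤ ∫⁻ p, ‖T ω (p.1 • unitDir p.2)‖ₑ ∂polarMeasure := by
        refine lintegral_mono fun p => ?_
        rw [enorm_mul]
        refine mul_le_of_le_one_left' ?_
        rw [← ofReal_norm]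
        exact ENNReal.ofReal_le_one.2 (hk _)
    _ ≤ ∫⁻ x, ‖fderiv ℝ (T ω) x‖ₑ := lintegral_polar_le _
    _ = ∫⁻ x, ‖fderiv ℝ ω x‖ₑ := by
        simp only [hT]
        exact lintegral_add_right_eq_self (fun x => ‖fderiv ℝ ω x‖ₑ) a

end Polar

local notation "D₀" => lineDerivOp (EuclideanSpace.single (0 : Fin 2) (1 : ℝ) : E2)
local notation "D₁" => lineDerivOp (EuclideanSpace.single (1 : Fin 2) (1 : ℝ) : E2)

lemma clm_eq_zero_of_single {F : Type*} [NormedAddCommGroup F] [NormedSpace ℝ F]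
    {L : E2 →L[ℝ] F} (h : ∀ i, L (EuclideanSpace.single i 1) = 0) : L = 0 := by
  ext x
  rw [← (EuclideanSpace.basisFun (Fin 2) ℝ).sum_repr x]
  simp [h]

lemma lineDerivOp_comm (u : SchwartzMap E2 ℝ) (a b : E2) :
    ∂_{a} (∂_{b} u) = ∂_{b} (∂_{a} u) := by
  have key : ∀ a b x, (∂_{a} (∂_{b} u) : SchwartzMap E2 ℝ) x = fderiv ℝ (fderiv ℝ u) x a b := by
    intro a b x
    have h : HasFDerivAt (fderiv ℝ u) (fderiv ℝ (fderiv ℝ u) x) x :=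
      (fderivCLM ℝ E2 ℝ u).differentiableAt.hasFDerivAt
    refine (DFunLike.congr_fun (h.clm_apply (hasFDerivAt_const b x)).fderiv a).trans ?_
    simp
  ext x
  rw [key, key]
  exact ((u.smooth 2).contDiffAt.isSymmSndFDerivAt (by simp)) a b

lemma integrable_mul_schwartz (f g : SchwartzMap E2 ℝ) : Integrable fun x => f x * g x :=
  (pairing (ContinuousLinearMap.mul ℝ ℝ) f g).integrable

/-- The energy identity for Schwartz functions on the plane. -/
lemma integral_sq_lineDerivOp (u : SchwartzMap E2 ℝ) (e : E2) :
    ∫ x, ∂_{e} u x * ∂_{e} u x = -∫ x, u x * ∂_{e} (∂_{e} u) x := by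
  simp only [integral_mul_lineDerivOp_right_eq_neg_left, mul_comm (u _)]

lemma integral_energy (u : SchwartzMap E2 ℝ) :
    ∫ x, (D₀ u x ^ 2 + D₁ u x ^ 2) = ∫ x, u x * -(D₀ (D₀ u) + D₁ (D₁ u)) x := by
  simp only [sq, add_apply, mul_neg, mul_add]
  rw [integral_neg, integral_add (integrable_mul_schwartz _ _) (integrable_mul_schwartz _ _),
    integral_add (integrable_mul_schwartz _ _) (integrable_mul_schwartz _ _),
    integral_sq_lineDerivOp, integral_sq_lineDerivOp]
  ring

/-- A harmonic Schwartz function vanishes. -/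
lemma eq_zero_of_laplacian_eq_zero (u : SchwartzMap E2 ℝ) (h : D₀ (D₀ u) + D₁ (D₁ u) = 0) :
    u = 0 := by
  have h0 := integral_energy u
  have hint : Integrable fun x => D₀ u x ^ 2 + D₁ u x ^ 2 := by
    simp only [sq]
    exact (integrable_mul_schwartz _ _).add (integrable_mul_schwartz _ _)
  simp only [h, zero_apply, neg_zero, mul_zero, integral_zero] at h0
  rw [integral_eq_zero_iff_of_nonneg (fun x => by positivity) hint,
    Continuous.ae_eq_iff_eq _ (by fun_prop) continuous_zero] at h0
  have hd : ∀ x, fderiv ℝ u x = 0 := fun x => by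
    have hx : D₀ u x ^ 2 + D₁ u x ^ 2 = 0 := congrFun h0 x
    refine clm_eq_zero_of_single fun i => ?_
    fin_cases i
    · exact pow_eq_zero_iff two_ne_zero |>.1 (by nlinarith [sq_nonneg (D₁ u x)] : D₀ u x ^ 2 = 0)
    · exact pow_eq_zero_iff two_ne_zero |>.1 (by nlinarith [sq_nonneg (D₀ u x)] : D₁ u x ^ 2 = 0)
  ext x
  have hc : ∀ r : ℝ, u (r • unitDir 0) = u x :=
    fun r => is_const_of_fderiv_eq_zero u.differentiable hd _ _
  have ht := tendsto_ray u 0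
  simp only [hc] at ht
  exact tendsto_nhds_unique tendsto_const_nhds ht

section BiotSavart

variable {ω v₀ v₁ : SchwartzMap E2 ℝ}

lemma divergence_eq_zero (h₀ : D₀ (D₀ v₀) + D₁ (D₁ v₀) = -D₁ ω)
    (h₁ : D₀ (D₀ v₁) + D₁ (D₁ v₁) = D₀ ω) : D₀ v₀ + D₁ v₁ = 0 := by
  refine eq_zero_of_laplacian_eq_zero _ ?_
  ext x
  have a := DFunLike.congr_fun (congrArg D₀ h₀) x
  have b := DFunLike.congr_fun (congrArg D₁ h₁) x
  have c (u : SchwartzMap E2 ℝ) : D₁ (D₀ u) = D₀ (D₁ u) := lineDerivOp_comm _ _ _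
  simp only [lineDerivOp_add, lineDerivOp_neg, c, add_apply, neg_apply, zero_apply] at a b ⊢
  linarith

lemma curl_eq (h₀ : D₀ (D₀ v₀) + D₁ (D₁ v₀) = -D₁ ω)
    (h₁ : D₀ (D₀ v₁) + D₁ (D₁ v₁) = D₀ ω) : D₀ v₁ - D₁ v₀ = ω := by
  refine sub_eq_zero.1 (eq_zero_of_laplacian_eq_zero _ ?_)
  ext x
  have a := DFunLike.congr_fun (congrArg D₁ h₀) x
  have b := DFunLike.congr_fun (congrArg D₀ h₁) x
  have c (u : SchwartzMap E2 ℝ) : D₁ (D₀ u) = D₀ (D₁ u) := lineDerivOp_comm _ _ _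
  simp only [sub_eq_add_neg, lineDerivOp_add, lineDerivOp_neg, c, add_apply, neg_apply,
    zero_apply] at a b ⊢
  linarith

lemma fderiv_unitDir (u : SchwartzMap E2 ℝ) (x : E2) (θ : ℝ) :
    fderiv ℝ u x (unitDir θ) = cos θ * D₀ u x + sin θ * D₁ u x := by
  simp [unitDir, lineDerivOp_apply_eq_fderiv]

lemma fderiv_unitTangent (u : SchwartzMap E2 ℝ) (x : E2) (θ : ℝ) :
    fderiv ℝ u x (unitTangent θ) = -sin θ * D₀ u x + cos θ * D₁ u x := by
  simp [unitTangent, lineDerivOp_apply_eq_fderiv]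

/-- Sup-norm bound for the plane vector field with divergence zero and curl `ω`. -/
lemma enorm_add_enorm_le (hdiv : D₀ v₀ + D₁ v₁ = 0) (hcurl : D₀ v₁ - D₁ v₀ = ω) (a : E2) :
    ‖v₀ a‖ₑ + ‖v₁ a‖ₑ ≤ ∫⁻ x, ‖fderiv ℝ ω x‖ₑ := by
  have hd (x : E2) : D₀ v₀ x + D₁ v₁ x = 0 := DFunLike.congr_fun hdiv x
  have hc (x : E2) : D₀ v₁ x - D₁ v₀ x = ω x := DFunLike.congr_fun hcurl x
  have h0 := enorm_apply_le v₀ v₁ ω (fun θ => -sin θ)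
    (fun θ => by simpa using abs_sin_le_one θ) (fun x θ => by
      rw [fderiv_unitDir, fderiv_unitTangent]
      linear_combination cos θ * hd x - sin θ * hc x) a
  have h1 := enorm_apply_le v₁ (-v₀) ω cos abs_cos_le_one (fun x θ => by
      rw [fderiv_unitDir, fderiv_unitTangent, lineDerivOp_neg, lineDerivOp_neg, neg_apply,
        neg_apply]
      linear_combination sin θ * hd x + cos θ * hc x) a
  have h := add_le_add h0 h1
  rw [← mul_add, ← two_mul] at h
  exact (ENNReal.mul_le_mul_iff_right two_ne_zero ENNReal.ofNat_ne_top).1 h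

end BiotSavart

/-- The operator norm is bounded by the Hilbert–Schmidt norm. -/
lemma opNorm_sq_le (L : E2 →L[ℝ] E2) :
    ‖L‖ ^ 2 ≤ ∑ j, (L (EuclideanSpace.single 0 1) j ^ 2 + L (EuclideanSpace.single 1 1) j ^ 2) := by
  set S := ∑ j, (L (EuclideanSpace.single 0 1) j ^ 2 + L (EuclideanSpace.single 1 1) j ^ 2)
    with hS
  have hS0 : 0 ≤ S := by positivity
  refine (Real.le_sqrt (norm_nonneg _) hS0).1 (L.opNorm_le_bound (sqrt_nonneg _) fun y => ?_)
  refine abs_le_of_sq_le_sq' ?_ (by positivity) |>.2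
  have hy : L y = y 0 • L (EuclideanSpace.single 0 1) + y 1 • L (EuclideanSpace.single 1 1) := by
    conv_lhs => rw [← (EuclideanSpace.basisFun (Fin 2) ℝ).sum_repr y]
    simp
  rw [mul_pow, sq_sqrt hS0, EuclideanSpace.norm_sq_eq, EuclideanSpace.norm_sq_eq, hy, hS]
  simp only [Fin.sum_univ_two, PiLp.add_apply, PiLp.smul_apply, smul_eq_mul, norm_eq_abs, sq_abs]
  set a := L (EuclideanSpace.single 0 1)
  set b := L (EuclideanSpace.single 1 1)
  nlinarith [sq_nonneg (y 0 * b 0 - y 1 * a 0), sq_nonneg (y 0 * b 1 - y 1 * a 1)]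

/-- The `j`-th component of a Schwartz vector field. -/
def component (j : Fin 2) (v : SchwartzMap E2 E2) : SchwartzMap E2 ℝ :=
  v.postcompCLM (EuclideanSpace.proj j : E2 →L[ℝ] ℝ)

lemma component_apply (j : Fin 2) (v : SchwartzMap E2 E2) (x : E2) : component j v x = v x j :=
  rfl

lemma lineDerivOp_component (j : Fin 2) (v : SchwartzMap E2 E2) (e : E2) :
    ∂_{e} (component j v) = component j (∂_{e} v) := by
  ext x
  exact DFunLike.congr_fun
    (((EuclideanSpace.proj j : E2 →L[ℝ] ℝ).hasFDerivAt.comp x (v.hasFDerivAt x)).fderiv) e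

lemma lap_apply_eq (v : SchwartzMap E2 E2) (x : E2) (j : Fin 2) :
    lap v x j = (D₀ (D₀ (component j v)) + D₁ (D₁ (component j v))) x := by
  simp only [lineDerivOp_component, add_apply, component_apply]
  simp only [lap, Fin.sum_univ_two, PiLp.add_apply]
  rfl

lemma enorm_le_add_components (y : E2) : ‖y‖ₑ ≤ ‖y 0‖ₑ + ‖y 1‖ₑ := by
  have h : y = y 0 • EuclideanSpace.single 0 1 + y 1 • EuclideanSpace.single 1 1 := by
    ext i
    fin_cases i <;> simp
  conv_lhs => rw [h]
  refine (enorm_add_le _ _).trans (le_of_eq ?_)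
  rw [enorm_smul, enorm_smul]
  simp [← ofReal_norm (EuclideanSpace.single _ (1 : ℝ))]

lemma lintegral_enorm_fderiv_sq_le (v : SchwartzMap E2 E2) (ω : SchwartzMap E2 ℝ)
    (h₀ : D₀ (D₀ (component 0 v)) + D₁ (D₁ (component 0 v)) = -D₁ ω)
    (h₁ : D₀ (D₀ (component 1 v)) + D₁ (D₁ (component 1 v)) = D₀ ω) :
    ∫⁻ x, ‖fderiv ℝ v x‖ₑ ^ 2 ≤ (∫⁻ x, ‖fderiv ℝ ω x‖ₑ) ^ 2 := by
  set N := ∫⁻ x, ‖fderiv ℝ ω x‖ₑ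
  have hint (u : SchwartzMap E2 ℝ) : Integrable fun x => D₀ u x ^ 2 + D₁ u x ^ 2 := by
    simp only [sq]
    exact (integrable_mul_schwartz _ _).add (integrable_mul_schwartz _ _)
  have hpart (i : Fin 2) (x : E2) : ‖fderiv ℝ ω x (EuclideanSpace.single i 1)‖ₑ ≤
      ‖fderiv ℝ ω x‖ₑ := by
    refine (ContinuousLinearMap.le_opENorm _ _).trans (le_of_eq ?_)
    simp [← ofReal_norm (EuclideanSpace.single i (1 : ℝ))]
  set G : E2 → ℝ := fun x => (D₀ (component 0 v) x ^ 2 + D₁ (component 0 v) x ^ 2) +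
    (D₀ (component 1 v) x ^ 2 + D₁ (component 1 v) x ^ 2)
  calc ∫⁻ x, ‖fderiv ℝ v x‖ₑ ^ 2
      ≤ ∫⁻ x, ENNReal.ofReal (G x) := by
        refine lintegral_mono fun x => ?_
        rw [← ofReal_norm, ← ENNReal.ofReal_pow (norm_nonneg _)]
        refine ENNReal.ofReal_le_ofReal ((opNorm_sq_le _).trans (le_of_eq ?_))
        simp only [G, lineDerivOp_component, component_apply, Fin.sum_univ_two]
        rfl
    _ = ENNReal.ofReal (∫ x, G x) :=
        (ofReal_integral_eq_lintegral_ofReal ((hint _).add (hint _))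
          (ae_of_all _ fun x => show 0 ≤ G x by positivity)).symm
    _ = ENNReal.ofReal (∫ x, (component 0 v x * D₁ ω x + component 1 v x * -D₀ ω x)) := by
        rw [integral_add (hint _) (hint _), integral_energy, integral_energy, h₀, h₁]
        simp only [neg_apply, neg_neg]
        congr 1
        exact (integral_add (integrable_mul_schwartz _ _)
          (integrable_mul_schwartz _ (-D₀ ω))).symm
    _ ≤ ∫⁻ x, ‖component 0 v x * D₁ ω x + component 1 v x * -D₀ ω x‖ₑ :=
        (Real.ofReal_le_enorm _).trans (enorm_integral_le_lintegral_enorm _)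
    _ ≤ ∫⁻ x, N * ‖fderiv ℝ ω x‖ₑ := by
        refine lintegral_mono fun x => (enorm_add_le _ _).trans ?_
        rw [enorm_mul, enorm_mul, enorm_neg]
        calc _ ≤ ‖component 0 v x‖ₑ * ‖fderiv ℝ ω x‖ₑ + ‖component 1 v x‖ₑ * ‖fderiv ℝ ω x‖ₑ := by
              gcongr
              · exact hpart 1 x
              · exact hpart 0 x
          _ ≤ N * ‖fderiv ℝ ω x‖ₑ := by
              rw [← add_mul]
              gcongr
              exact enorm_add_enorm_le (divergence_eq_zero h₀ h₁) (curl_eq h₀ h₁) x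
    _ = N ^ 2 := by
        have hm : Measurable fun x => ‖fderiv ℝ ω x‖ₑ :=
          (fderivCLM ℝ E2 ℝ ω).continuous.enorm.measurable
        rw [lintegral_const_mul _ hm, sq]

/-- **Bourgain–Brezis estimate, 2D (Proposition 2(b)).**
There is a universal constant `C > 0` such that for all Schwartz functions
`ω : ℝ² → ℝ` and `v : ℝ² → ℝ²` satisfying the two-dimensional Biot–Savart
relation `−Δv = (∂₂ω, −∂₁ω)`, one has
`‖v‖_{L^∞(ℝ²)} + ‖∇v‖_{L²(ℝ²)} ≤ C ‖∇ω‖_{L¹(ℝ²)}`. -/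
theorem bourgain_brezis_biot_savart_2d :
    ∃ C : ℝ, 0 < C ∧
      ∀ (ω : SchwartzMap E2 ℝ) (v : SchwartzMap E2 E2),
        (∀ x : E2, -(lap (⇑v) x) =
            (EuclideanSpace.equiv (Fin 2) ℝ).symm ![pd 1 (⇑ω) x, -(pd 0 (⇑ω) x)]) →
        eLpNorm (⇑v) ⊤ volume + eLpNorm (fun x => fderiv ℝ (⇑v) x) 2 volume ≤
          ENNReal.ofReal C * eLpNorm (fun x => fderiv ℝ (⇑ω) x) 1 volume := by
  refine ⟨2, two_pos, fun ω v h => ?_⟩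
  have h₀ : D₀ (D₀ (component 0 v)) + D₁ (D₁ (component 0 v)) = -D₁ ω := by
    ext x
    have hx := congrArg (fun y : E2 => y 0) (h x)
    rw [← lap_apply_eq]
    exact neg_eq_iff_eq_neg.1 hx
  have h₁ : D₀ (D₀ (component 1 v)) + D₁ (D₁ (component 1 v)) = D₀ ω := by
    ext x
    have hx := congrArg (fun y : E2 => y 1) (h x)
    rw [← lap_apply_eq]
    exact neg_injective hx
  rw [eLpNorm_one_eq_lintegral_enorm, ENNReal.ofReal_ofNat, two_mul]
  refine add_le_add ?_ ?_
  · rw [eLpNorm_exponent_top]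
    exact eLpNormEssSup_le_of_ae_enorm_bound (ae_of_all _ fun x =>
      (enorm_le_add_components _).trans
        (enorm_add_enorm_le (divergence_eq_zero h₀ h₁) (curl_eq h₀ h₁) x))
  · rw [eLpNorm_eq_lintegral_rpow_enorm_toReal two_ne_zero ENNReal.ofNat_ne_top]
    simp only [ENNReal.toReal_ofNat, one_div]
    rw [ENNReal.rpow_inv_le_iff two_pos]
    simpa only [ENNReal.rpow_ofNat] using lintegral_enorm_fderiv_sq_le v ω h₀ h₁

end
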